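/- arXiv:2605.23248 — 3 statements merged into one kernel-verified Lean document; each statement's English description precedes it below -/
import Mathlib

section
/- Assume (A1) and (A2). Let (η,v,l) ∈ SP(x) be a minimizer of the value function u at (x,t), and let p(s) := D_vL(η(s),−v(s)). Then for almost every s ∈ [0,t] with η(s) ∈ ∂Ω, the reflection term satisfies l(s) = −D_pH(η(s), p(s)) · ν(η(s)). -/
open MeasureTheory Set Filter
open scoped RealInnerProductSpace Classical

noncomputable section

/-- `Euc n` is the Euclidean space `ℝⁿ`. -/
abbrev Euc (n : ℕ) := EuclideanSpace ℝ (Fin n)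

/-- The Legendre transform `L(x,v) := sup_p (v·p − H(x,p))`. -/
def legendre {n : ℕ} (H : Euc n → Euc n → ℝ) (x v : Euc n) : ℝ :=
  ⨆ p : Euc n, (⟪v, p⟫ - H x p)

/-- Assumption (A1) on the Hamiltonian. -/
def A1 {n : ℕ} (H : Euc n → Euc n → ℝ) : Prop :=
  ContDiff ℝ 2 (fun q : Euc n × Euc n => H q.1 q.2) ∧
  (∀ R > (0:ℝ), ∃ C > (0:ℝ), ∀ x p : Euc n, ‖p‖ ≤ R → ∀ i : ℕ, i ≤ 2 →
      ‖iteratedFDeriv ℝ i (fun q : Euc n × Euc n => H q.1 q.2) (x, p)‖ ≤ C) ∧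
  (∃ α₀ > (0:ℝ), ∀ x p w : Euc n,
      (w ≠ 0 → 0 < iteratedFDeriv ℝ 2 (H x) p ![w, w]) ∧
      iteratedFDeriv ℝ 2 (H x) p ![w, w] ≤ α₀ * ‖w‖ ^ 2) ∧
  (∀ R > (0:ℝ), ∀ M : ℝ, ∃ K : ℝ, ∀ x p : Euc n, ‖x‖ ≤ R → K ≤ ‖p‖ → M * ‖p‖ ≤ H x p)

/-- Assumption (A2) on the data `g`, `u₀`. -/
def A2 {n : ℕ} (g u₀ : Euc n → ℝ) : Prop :=
  ContDiff ℝ 1 g ∧ ContDiff ℝ 1 u₀ ∧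
    ∃ C : ℝ, ∀ x : Euc n, |g x| + ‖gradient g x‖ + |u₀ x| + ‖gradient u₀ x‖ ≤ C

/-- Assumption (A3): splitting of the Hamiltonian into tangential and normal parts
on the boundary. -/
def A3 {n : ℕ} (Ω : Set (Euc n)) (ν : Euc n → Euc n) (H : Euc n → Euc n → ℝ) : Prop :=
  ∃ H₁ H₂ : Euc n → Euc n → ℝ,
    ContDiff ℝ 2 (fun q : Euc n × Euc n => H₁ q.1 q.2) ∧
    ContDiff ℝ 2 (fun q : Euc n × Euc n => H₂ q.1 q.2) ∧
    (∀ x ∈ frontier Ω, ∀ p : Euc n,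
        H x p = H₁ x (p - ⟪p, ν x⟫ • ν x) + H₂ x (⟪p, ν x⟫ • ν x) ∧
        H₁ x p = H₁ x (p - ⟪p, ν x⟫ • ν x) ∧
        H₂ x p = H₂ x (⟪p, ν x⟫ • ν x)) ∧
    (∀ x ∈ frontier Ω, ⟪gradient (H₂ x) 0, ν x⟫ = 0)

/-- `Ω` has a `C²` boundary with outward unit normal field `ν`. -/
def HasC2BoundaryNormal {n : ℕ} (Ω : Set (Euc n)) (ν : Euc n → Euc n) : Prop :=
  ∃ ψ : Euc n → ℝ, ContDiff ℝ 2 ψ ∧ Ω = {x | ψ x < 0} ∧ frontier Ω = {x | ψ x = 0} ∧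
    ∀ x ∈ frontier Ω, gradient ψ x ≠ 0 ∧ ‖ν x‖ = 1 ∧
      gradient ψ x = ‖gradient ψ x‖ • ν x

/-- The Skorokhod problem: `(η, v, l) ∈ SP(x)`, where `η'` is the a.e. derivative of the
(locally absolutely continuous) curve `η`. -/
structure IsSP {n : ℕ} (Ω : Set (Euc n)) (ν : Euc n → Euc n) (x : Euc n)
    (η η' v : ℝ → Euc n) (l : ℝ → ℝ) : Prop where
  init : η 0 = x
  mem : ∀ s : ℝ, 0 ≤ s → η s ∈ closure Ω
  integrable_eta' : ∀ T > (0:ℝ), IntegrableOn η' (Icc 0 T)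
  integrable_v : ∀ T > (0:ℝ), IntegrableOn v (Icc 0 T)
  integrable_l : ∀ T > (0:ℝ), IntegrableOn l (Icc 0 T)
  rep : ∀ s : ℝ, 0 ≤ s → η s = x + ∫ r in Ioc (0:ℝ) s, η' r
  deriv_ae : ∀ᵐ s ∂(volume.restrict (Ioi (0:ℝ))), HasDerivAt η (η' s) s
  reflect : ∀ᵐ s ∂(volume.restrict (Ioi (0:ℝ))), η' s + l s • ν (η s) = v s
  l_nonneg : ∀ᵐ s ∂(volume.restrict (Ioi (0:ℝ))), 0 ≤ l s
  l_zero : ∀ᵐ s ∂(volume.restrict (Ioi (0:ℝ))), η s ∈ Ω → l s = 0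

/-- The cost functional of the Skorokhod representation formula. -/
def SPcost {n : ℕ} (L : Euc n → Euc n → ℝ) (g u₀ : Euc n → ℝ)
    (t : ℝ) (η v : ℝ → Euc n) (l : ℝ → ℝ) : ℝ :=
  (∫ s in Ioc (0:ℝ) t, (L (η s) (-(v s)) + g (η s) * l s)) + u₀ (η t)

/-- The value function `u(x,t)` given by the Skorokhod representation formula. -/
def valueFun {n : ℕ} (Ω : Set (Euc n)) (ν : Euc n → Euc n)
    (L : Euc n → Euc n → ℝ) (g u₀ : Euc n → ℝ) (x : Euc n) (t : ℝ) : ℝ :=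
  sInf {c : ℝ | ∃ η η' v l, IsSP Ω ν x η η' v l ∧ c = SPcost L g u₀ t η v l}

/-- `(η, v, l) ∈ SP(x)` (with a.e. derivative `η'`) is a minimizer of the value
function at `(x,t)`. -/
def IsMinimizer {n : ℕ} (Ω : Set (Euc n)) (ν : Euc n → Euc n)
    (L : Euc n → Euc n → ℝ) (g u₀ : Euc n → ℝ) (x : Euc n) (t : ℝ)
    (η η' v : ℝ → Euc n) (l : ℝ → ℝ) : Prop :=
  IsSP Ω ν x η η' v l ∧ SPcost L g u₀ t η v l = valueFun Ω ν L g u₀ x t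

/-- The generalized momentum `p(s) := D_v L(η(s), −v(s))`. -/
def mom {n : ℕ} (H : Euc n → Euc n → ℝ) (η v : ℝ → Euc n) (s : ℝ) : Euc n :=
  gradient (legendre H (η s)) (-(v s))

/-- The projected momentum `p̄`. -/
def projMom {n : ℕ} (Ω : Set (Euc n)) (ν : Euc n → Euc n)
    (H : Euc n → Euc n → ℝ) (η v : ℝ → Euc n) (s : ℝ) : Euc n :=
  if η s ∈ Ω then mom H η v s
  else mom H η v s - ⟪mom H η v s, ν (η s)⟫ • ν (η s)

/-- A `C²` function with positive definite Hessian is strictly convex. -/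
lemma strictConvexOn_univ_of_iteratedFDeriv_two_pos {E : Type*} [NormedAddCommGroup E]
    [NormedSpace ℝ E] {f : E → ℝ} (hf : ContDiff ℝ 2 f)
    (hpos : ∀ p w : E, w ≠ 0 → 0 < iteratedFDeriv ℝ 2 f p ![w, w]) :
    StrictConvexOn ℝ univ f := by
  refine ⟨convex_univ, fun p _ q _ hpq a b ha hb hab => ?_⟩
  set d := q - p with hd
  have hd0 : d ≠ 0 := sub_ne_zero.mpr hpq.symm
  have hline : ∀ r : ℝ, HasDerivAt (fun r : ℝ => p + r • d) d r := fun r => by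
    simpa using ((hasDerivAt_id r).smul_const d).const_add p
  have h1 : ∀ r : ℝ, HasDerivAt (fun r : ℝ => f (p + r • d)) (fderiv ℝ f (p + r • d) d) r :=
    fun r => ((hf.differentiable (by norm_num)) _).hasFDerivAt.comp_hasDerivAt r (hline r)
  have hf' : Differentiable ℝ (fderiv ℝ f) :=
    (hf.fderiv_right (m := 1) (by norm_num)).differentiable (by norm_num)
  have h2 : ∀ r : ℝ, HasDerivAt (fun r : ℝ => fderiv ℝ f (p + r • d) d)
      (fderiv ℝ (fderiv ℝ f) (p + r • d) d d) r := fun r => by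
    have := ((hf' _).hasFDerivAt.comp_hasDerivAt r (hline r)).clm_apply (hasDerivAt_const r d)
    simpa using this
  have hconv : StrictConvexOn ℝ univ (fun r : ℝ => f (p + r • d)) := by
    refine strictConvexOn_univ_of_deriv2_pos
      (continuous_iff_continuousAt.mpr fun r => (h1 r).continuousAt) fun r => ?_
    have e : deriv (fun r : ℝ => f (p + r • d)) = fun r => fderiv ℝ f (p + r • d) d :=
      funext fun r => (h1 r).deriv
    have := hpos (p + r • d) d hd0
    rw [iteratedFDeriv_two_apply] at this
    simpa [e, (h2 r).deriv] using this
  have key := hconv.2 (mem_univ (0 : ℝ)) (mem_univ (1 : ℝ)) zero_ne_one ha hb hab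
  have e1 : p + b • d = a • p + b • q := by
    rw [hd, eq_sub_of_add_eq hab]; module
  simp only [smul_eq_mul, mul_zero, mul_one, zero_add, zero_smul, add_zero, one_smul, e1] at key
  simpa [hd] using key

/-- If `h` is convex, nonnegative, continuous and vanishes only at `p₀`, then it grows at least
linearly away from `p₀`. -/
lemma exists_linear_lower_bound {E : Type*} [NormedAddCommGroup E] [NormedSpace ℝ E]
    [ProperSpace E] {h : E → ℝ} (hc : Continuous h) (hconv : ConvexOn ℝ univ h) {p₀ : E}
    (h0 : h p₀ = 0) (hpos : ∀ p, p ≠ p₀ → 0 < h p) {ε : ℝ} (hε : 0 < ε) :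
    ∃ c > 0, ∀ p, ε ≤ ‖p - p₀‖ → c * ‖p - p₀‖ ≤ h p := by
  obtain ⟨m, hm, hmle⟩ := (isCompact_sphere p₀ ε).exists_forall_le' hc.continuousOn
    (a := 0) fun b hb => hpos b (Metric.ne_of_mem_sphere hb hε.ne')
  refine ⟨m / ε, div_pos hm hε, fun p hp => ?_⟩
  set r := ‖p - p₀‖ with hr
  have hr0 : 0 < r := hε.trans_le hp
  have hq := hmle (p₀ + (ε / r) • (p - p₀)) (by
    rw [mem_sphere_iff_norm, add_sub_cancel_left, norm_smul, ← hr, Real.norm_eq_abs,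
      abs_of_pos (div_pos hε hr0), div_mul_cancel₀ _ hr0.ne'])
  have hle : ε / r ≤ 1 := (div_le_one hr0).mpr hp
  have hcv := hconv.2 (mem_univ p₀) (mem_univ p) (sub_nonneg.mpr hle)
    (div_pos hε hr0).le (by ring)
  have e : (1 - ε / r) • p₀ + (ε / r) • p = p₀ + (ε / r) • (p - p₀) := by module
  rw [e, h0, smul_zero, zero_add, smul_eq_mul] at hcv
  have h3 := hq.trans hcv
  rw [div_mul_eq_mul_div, div_le_iff₀ hε]
  rw [div_mul_eq_mul_div, le_div_iff₀ hr0] at h3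
  linarith

/-- At a slope `w` where the strictly convex function `H x - ⟪w, ·⟫` attains its minimum at `p₀`,
the Legendre transform is differentiable with gradient `p₀`. -/
lemma hasGradientAt_legendre {n : ℕ} {H : Euc n → Euc n → ℝ} {x w p₀ : Euc n}
    (hc : Continuous (H x)) (hconv : StrictConvexOn ℝ univ (H x))
    (hmin : ∀ p, H x p₀ - ⟪w, p₀⟫ ≤ H x p - ⟪w, p⟫) :
    HasGradientAt (legendre H x) p₀ w := by
  set h : Euc n → ℝ := fun p => H x p - ⟪w, p⟫ - (H x p₀ - ⟪w, p₀⟫) with hh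
  have hhc : Continuous h := by fun_prop
  have hsc : StrictConvexOn ℝ univ h := by
    refine ⟨convex_univ, fun p _ q _ hpq a b ha hb hab => ?_⟩
    have := hconv.2 (mem_univ p) (mem_univ q) hpq ha hb hab
    simp only [hh, smul_eq_mul, inner_add_right, inner_smul_right] at this ⊢
    linear_combination this + (H x p₀ - ⟪w, p₀⟫) * hab
  have hnn : ∀ p, 0 ≤ h p := fun p => sub_nonneg.mpr (hmin p)
  have h0 : h p₀ = 0 := sub_self _
  have hpos : ∀ p, p ≠ p₀ → 0 < h p := fun p hp => by
    refine (hnn p).lt_of_ne' fun hp0 => ?_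
    have := hsc.2 (mem_univ p) (mem_univ p₀) hp (one_half_pos (α := ℝ)) one_half_pos
      (add_halves 1)
    rw [hp0, h0, smul_zero, add_zero] at this
    exact absurd (hnn _) (not_le.mpr this)
  have expand : ∀ w' p : Euc n, ⟪w', p⟫ - H x p
      = ⟪w', p₀⟫ - H x p₀ + (⟪w' - w, p - p₀⟫ - h p) := fun w' p => by
    simp only [hh, inner_sub_left, inner_sub_right]; ring
  have bound : ∀ ε > 0, ∃ c > 0, ∀ w' : Euc n, ‖w' - w‖ ≤ c → ∀ p,
      ⟪w', p⟫ - H x p ≤ ⟪w', p₀⟫ - H x p₀ + ε * ‖w' - w‖ := fun ε hε => by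
    obtain ⟨c, hc0, hcl⟩ := exists_linear_lower_bound hhc hsc.convexOn h0 hpos hε
    refine ⟨c, hc0, fun w' hw' p => ?_⟩
    rw [expand]
    have hcs := real_inner_le_norm (w' - w) (p - p₀)
    have hw0 := norm_nonneg (w' - w)
    have hp0 := norm_nonneg (p - p₀)
    rcases le_total ε ‖p - p₀‖ with hp | hp
    · have := hcl p hp
      nlinarith [mul_le_mul_of_nonneg_right hw' hp0, mul_nonneg hε.le hw0]
    · nlinarith [hnn p, mul_le_mul_of_nonneg_left hp hw0]
  have hw : legendre H x w = ⟪w, p₀⟫ - H x p₀ := by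
    refine le_antisymm (ciSup_le fun p => by linarith [hmin p]) ?_
    exact le_ciSup (f := fun p => ⟪w, p⟫ - H x p)
      ⟨⟪w, p₀⟫ - H x p₀, by rintro _ ⟨p, rfl⟩; dsimp only; linarith [hmin p]⟩ p₀
  rw [hasGradientAt_iff_isLittleO, Asymptotics.isLittleO_iff]
  intro ε hε
  obtain ⟨c, hc0, hb⟩ := bound ε hε
  filter_upwards [Metric.closedBall_mem_nhds w hc0] with w' hw'
  rw [mem_closedBall_iff_norm] at hw'
  have hle : legendre H x w' ≤ _ := ciSup_le (hb w' hw')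
  have hge : ⟪w', p₀⟫ - H x p₀ ≤ legendre H x w' :=
    le_ciSup (f := fun p => ⟪w', p⟫ - H x p) ⟨_, by rintro _ ⟨p, rfl⟩; exact hb w' hw' p⟩ p₀
  have e : ⟪p₀, w' - w⟫ = ⟪w', p₀⟫ - ⟪w, p₀⟫ := by
    rw [real_inner_comm, inner_sub_left]
  rw [hw, e, Real.norm_eq_abs, abs_le]
  constructor
  · nlinarith [norm_nonneg (w' - w), mul_nonneg hε.le (norm_nonneg (w' - w))]
  · linarith

/-- The gradient of the Legendre transform inverts `D_pH(x, ·)`. -/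
lemma gradient_gradient_legendre {n : ℕ} {H : Euc n → Euc n → ℝ} (hA1 : A1 H) (x w : Euc n) :
    gradient (H x) (gradient (legendre H x) w) = w := by
  obtain ⟨hC, -, ⟨α, -, hα⟩, hsup⟩ := hA1
  have hCx : ContDiff ℝ 2 (H x) := hC.comp (contDiff_const.prodMk contDiff_id)
  have hconv := strictConvexOn_univ_of_iteratedFDeriv_two_pos hCx fun p w => (hα x p w).1
  have hcont : Continuous fun p => H x p - ⟪w, p⟫ := by
    have := hCx.continuous
    fun_prop
  have hlim : Tendsto (fun p => H x p - ⟪w, p⟫) (cocompact (Euc n)) atTop := by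
    obtain ⟨K, hK⟩ := hsup (‖x‖ + 1) (by positivity) (‖w‖ + 1)
    refine tendsto_atTop_mono' _ ?_ (tendsto_norm_cocompact_atTop (E := Euc n))
    filter_upwards [(tendsto_norm_cocompact_atTop (E := Euc n)).eventually_ge_atTop K] with p hp
    linarith [hK x p (by linarith) hp, real_inner_le_norm w p]
  obtain ⟨p₀, hp₀⟩ := hcont.exists_forall_le hlim
  rw [(hasGradientAt_legendre hCx.continuous hconv hp₀).gradient]
  have hd : HasFDerivAt (fun p => H x p - ⟪w, p⟫) (fderiv ℝ (H x) p₀ - innerSL ℝ w) p₀ :=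
    ((hCx.differentiable (by norm_num)) p₀).hasFDerivAt.sub (innerSL ℝ w).hasFDerivAt
  have hz := IsLocalMin.hasFDerivAt_eq_zero (Eventually.of_forall hp₀) hd
  refine HasGradientAt.gradient ?_
  rw [hasGradientAt_iff_hasFDerivAt]
  have : (InnerProductSpace.toDual ℝ (Euc n)) w = fderiv ℝ (H x) p₀ := by
    rw [sub_eq_zero.mp hz]; ext; simp
  rw [this]
  exact ((hCx.differentiable (by norm_num)) p₀).hasFDerivAt

/-- A curve staying in `closure Ω` has tangential velocity whenever it touches the boundary at an
interior time. -/
lemma inner_deriv_normal_eq_zero {n : ℕ} {Ω : Set (Euc n)} {ν : Euc n → Euc n}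
    (hbd : HasC2BoundaryNormal Ω ν) {η : ℝ → Euc n} {e : Euc n} {s : ℝ}
    (hη : ∀ᶠ r in nhds s, η r ∈ closure Ω) (hd : HasDerivAt η e s) (hs : η s ∈ frontier Ω) :
    ⟪e, ν (η s)⟫ = 0 := by
  obtain ⟨ψ, hψ, hΩ, hfr, hν⟩ := hbd
  obtain ⟨hne, -, hgr⟩ := hν _ hs
  have hcl : closure Ω ⊆ {y | ψ y ≤ 0} :=
    closure_minimal (fun y hy => by rw [hΩ] at hy; exact LT.lt.le (a := ψ y) hy)
      (isClosed_le hψ.continuous continuous_const)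
  have hs0 : ψ (η s) = 0 := by rw [hfr] at hs; exact hs
  have hder := ((hψ.differentiable (by norm_num)) (η s)).hasGradientAt.hasFDerivAt.comp_hasDerivAt
    s hd
  have hmax : IsLocalMax (ψ ∘ η) s := by
    filter_upwards [hη] with r hr
    simpa [hs0] using hcl hr
  have hz := hmax.hasDerivAt_eq_zero hder
  rw [InnerProductSpace.toDual_apply_apply, hgr, inner_smul_left] at hz
  rw [real_inner_comm]
  exact (mul_eq_zero.mp hz).resolve_left (by simpa using hne)

/-- Theorem 4.2, first part: along a minimizer, at almost every boundary time the reflection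
term is `l(s) = −D_pH(η(s), p(s))·ν(η(s))`. -/
theorem reflection_term_formula {n : ℕ}
    (Ω : Set (Euc n)) (ν : Euc n → Euc n) (H : Euc n → Euc n → ℝ) (g u₀ : Euc n → ℝ)
    (hΩopen : IsOpen Ω) (hΩconn : IsConnected Ω)
    (hbd : HasC2BoundaryNormal Ω ν)
    (hA1 : A1 H) (hA2 : A2 g u₀)
    (x : Euc n) (t : ℝ) (hx : x ∈ closure Ω) (ht : 0 < t)
    (η η' v : ℝ → Euc n) (l : ℝ → ℝ)
    (hmin : IsMinimizer Ω ν (legendre H) g u₀ x t η η' v l) :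
    ∀ᵐ s ∂(volume.restrict (Ioc (0:ℝ) t)),
      η s ∈ frontier Ω →
        l s = -⟪gradient (H (η s)) (mom H η v s), ν (η s)⟫ := by
  obtain ⟨hSP, -⟩ := hmin
  have hmono : volume.restrict (Ioc (0:ℝ) t) ≤ volume.restrict (Ioi (0:ℝ)) :=
    Measure.restrict_mono Ioc_subset_Ioi_self le_rfl
  filter_upwards [ae_mono hmono hSP.deriv_ae, ae_mono hmono hSP.reflect,
    ae_restrict_mem measurableSet_Ioc] with s hd hr hs hfr
  have htan := inner_deriv_normal_eq_zero hbd
    ((eventually_gt_nhds hs.1).mono fun r hr => hSP.mem r hr.le) hd hfr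
  have hnorm : ‖ν (η s)‖ = 1 := by
    obtain ⟨ψ, -, -, -, hν⟩ := hbd
    exact (hν _ hfr).2.1
  rw [mom, gradient_gradient_legendre hA1, inner_neg_left, neg_neg, ← hr, inner_add_left, htan,
    inner_smul_left, real_inner_self_eq_norm_sq, hnorm]
  simp

end
end

section
/- Define F(h) := −arccos(1/(1+2h)) + 2 arccos(1/(1+h)) + √((1+2h)² − 1) − 2√((1+h)² − 1) for h > 0. Then F(h) = ((8 − 4√2)/3) · h^{3/2} + o(h^{3/2}) as h → 0⁺; in particular, since (8 − 4√2)/3 > 0, F(h)/h^{3/2} converges to the positive constant (8 − 4√2)/3 as h → 0⁺. -/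
open Filter Set

/-- The cubic leading term of `x - arctan x` at `0⁺`. -/
theorem tendsto_sub_arctan_div_cube :
    Tendsto (fun x : ℝ => (x - Real.arctan x) / x ^ 3) (nhdsWithin 0 (Ioi 0)) (nhds (1 / 3)) := by
  refine HasDerivAt.lhopital_zero_nhdsGT (f' := fun x => 1 - 1 / (1 + x ^ 2))
    (g' := fun x => 3 * x ^ 2) ?_ ?_ ?_ ?_ ?_ ?_
  · exact Eventually.of_forall fun x => (hasDerivAt_id x).sub (Real.hasDerivAt_arctan x)
  · exact Eventually.of_forall fun x => by simpa using hasDerivAt_pow 3 x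
  · filter_upwards [self_mem_nhdsWithin] with x (hx : 0 < x)
    positivity
  · have h : Continuous fun x : ℝ => x - Real.arctan x :=
      continuous_id.sub Real.continuous_arctan
    simpa using (h.tendsto 0).mono_left nhdsWithin_le_nhds
  · have h : Continuous fun x : ℝ => x ^ 3 := by fun_prop
    simpa using (h.tendsto 0).mono_left nhdsWithin_le_nhds
  · have h : Continuous fun x : ℝ => 1 / (3 * (1 + x ^ 2)) := by
      refine continuous_const.div (by fun_prop) fun x => by positivity
    have h0 : Tendsto (fun x : ℝ => 1 / (3 * (1 + x ^ 2))) (nhdsWithin 0 (Ioi 0))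
        (nhds (1 / 3)) := by
      simpa using (h.tendsto 0).mono_left nhdsWithin_le_nhds
    refine h0.congr' ?_
    filter_upwards [self_mem_nhdsWithin] with x (hx : 0 < x)
    field_simp
    ring

theorem arccos_one_div_one_add {r : ℝ} (hr : 0 < r) :
    Real.arccos (1 / (1 + r)) = Real.arctan (√((1 + r) ^ 2 - 1)) := by
  rw [Real.arctan_eq_arccos (Real.sqrt_nonneg _), Real.sq_sqrt (by nlinarith),
    add_sub_cancel, Real.sqrt_sq (by positivity), one_div]

theorem tendsto_sqrt_sub_arccos_div_rpow :
    Tendsto (fun r : ℝ => (√((1 + r) ^ 2 - 1) - Real.arccos (1 / (1 + r))) / r ^ ((3 : ℝ) / 2))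
      (nhdsWithin 0 (Ioi 0)) (nhds (2 * √2 / 3)) := by
  have hs : Tendsto (fun r : ℝ => √((1 + r) ^ 2 - 1)) (nhdsWithin 0 (Ioi 0))
      (nhdsWithin 0 (Ioi 0)) := by
    refine tendsto_nhdsWithin_iff.2 ⟨?_, ?_⟩
    · have h : Continuous fun r : ℝ => √((1 + r) ^ 2 - 1) := by fun_prop
      simpa using (h.tendsto 0).mono_left nhdsWithin_le_nhds
    · filter_upwards [self_mem_nhdsWithin] with r (hr : 0 < r)
      exact Real.sqrt_pos.2 (by nlinarith)
  have hq : Tendsto (fun r : ℝ => √(2 + r) ^ 3) (nhdsWithin 0 (Ioi 0)) (nhds (√2 ^ 3)) := by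
    have h : Continuous fun r : ℝ => √(2 + r) ^ 3 := by fun_prop
    simpa using (h.tendsto 0).mono_left nhdsWithin_le_nhds
  have hlim : 1 / 3 * √2 ^ 3 = 2 * √2 / 3 := by
    rw [pow_succ, Real.sq_sqrt (by norm_num)]
    ring
  rw [← hlim]
  refine ((tendsto_sub_arctan_div_cube.comp hs).mul hq).congr' ?_
  filter_upwards [self_mem_nhdsWithin] with r (hr : 0 < r)
  have hfac : √((1 + r) ^ 2 - 1) = √r * √(2 + r) := by
    rw [← Real.sqrt_mul hr.le]
    ring_nf
  have hpow : r ^ ((3 : ℝ) / 2) = √r ^ 3 := by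
    rw [Real.sqrt_eq_rpow, ← Real.rpow_natCast, ← Real.rpow_mul hr.le]
    norm_num
  have h1 : 0 < √r := Real.sqrt_pos.2 hr
  have h2 : 0 < √(2 + r) := Real.sqrt_pos.2 (by linarith)
  rw [arccos_one_div_one_add hr, Function.comp_apply, hfac, hpow]
  field_simp

/-- Optimality of the exponent `1/2`: for
`F(h) := −arccos(1/(1+2h)) + 2 arccos(1/(1+h)) + √((1+2h)² − 1) − 2√((1+h)² − 1)`
one has `F(h) = ((8 − 4√2)/3)·h^{3/2} + o(h^{3/2})` as `h → 0⁺`; in particular, since the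
coefficient is positive, `F(h)/h^{3/2}` converges to the positive constant `(8 − 4√2)/3`. -/
theorem optimality_expansion (F : ℝ → ℝ)
    (hF : ∀ h : ℝ, F h = -Real.arccos (1 / (1 + 2*h)) + 2 * Real.arccos (1 / (1 + h))
        + Real.sqrt ((1 + 2*h)^2 - 1) - 2 * Real.sqrt ((1 + h)^2 - 1)) :
    Tendsto (fun h : ℝ => (F h - ((8 - 4 * Real.sqrt 2) / 3) * h ^ ((3:ℝ)/2)) / h ^ ((3:ℝ)/2))
        (nhdsWithin 0 (Ioi 0)) (nhds 0)
      ∧ 0 < (8 - 4 * Real.sqrt 2) / 3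
      ∧ Tendsto (fun h : ℝ => F h / h ^ ((3:ℝ)/2)) (nhdsWithin 0 (Ioi 0))
          (nhds ((8 - 4 * Real.sqrt 2) / 3)) := by
  have hpos : 0 < (8 - 4 * √2) / 3 := by
    have : √2 < 2 := by rw [Real.sqrt_lt' (by norm_num)]; norm_num
    linarith
  have hdouble : Tendsto (fun h : ℝ => 2 * h) (nhdsWithin 0 (Ioi 0)) (nhdsWithin 0 (Ioi 0)) := by
    refine tendsto_nhdsWithin_iff.2 ⟨?_, ?_⟩
    · have h : Continuous fun h : ℝ => 2 * h := by fun_prop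
      simpa using (h.tendsto 0).mono_left nhdsWithin_le_nhds
    · filter_upwards [self_mem_nhdsWithin] with h (hh : 0 < h)
      exact mul_pos two_pos hh
  have htwo : (2 : ℝ) ^ ((3 : ℝ) / 2) = 2 * √2 := by
    rw [show (3 : ℝ) / 2 = 1 + 1 / 2 by norm_num, Real.rpow_add two_pos, Real.rpow_one,
      Real.sqrt_eq_rpow]
  have hlim : 2 * √2 * (2 * √2 / 3) - 2 * (2 * √2 / 3) = (8 - 4 * √2) / 3 := by
    have := Real.mul_self_sqrt (show (0 : ℝ) ≤ 2 by norm_num)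
    linear_combination 4 / 3 * this
  have hmain : Tendsto (fun h : ℝ => F h / h ^ ((3 : ℝ) / 2)) (nhdsWithin 0 (Ioi 0))
      (nhds ((8 - 4 * √2) / 3)) := by
    rw [← hlim]
    refine (((tendsto_sqrt_sub_arccos_div_rpow.comp hdouble).const_mul (2 * √2)).sub
      (tendsto_sqrt_sub_arccos_div_rpow.const_mul 2)).congr' ?_
    filter_upwards [self_mem_nhdsWithin] with h (hh : 0 < h)
    have hp : 0 < h ^ ((3 : ℝ) / 2) := Real.rpow_pos_of_pos hh _
    have h2 : 0 < √(2 : ℝ) := Real.sqrt_pos.2 two_pos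
    rw [hF, Function.comp_apply, Real.mul_rpow two_pos.le hh.le, htwo]
    field_simp
    ring
  refine ⟨?_, hpos, hmain⟩
  have hsub := hmain.sub_const ((8 - 4 * √2) / 3)
  rw [sub_self] at hsub
  refine hsub.congr' ?_
  filter_upwards [self_mem_nhdsWithin] with h (hh : 0 < h)
  rw [sub_div (F h), mul_div_cancel_right₀ _ (Real.rpow_pos_of_pos hh _).ne']
end

section
/- For h ∈ [0,2), define θ₀(h) := 2 arctan((2−h)/2) + h/2 and f(h) := |sin θ₀(h) + θ₀(h) − π|. Then: (i) f(0) = π/2 − 1; (ii) f is differentiable on (0,2) with f'(h) = h(4−h) cos²(h/4 + arctan(1 − h/2)) / (h² − 4h + 8), and f'(h) > 0 for all h ∈ (0,2); (iii) consequently f(h) > π/2 − 1 for all h ∈ (0,2). -/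
open Set

lemma half_opening_angle_mem_Ioo {h : ℝ} (hh : h ∈ Ioo (0 : ℝ) 2) :
    h / 4 + Real.arctan (1 - h / 2) ∈ Ioo 0 (Real.pi / 2) := by
  obtain ⟨h0, h2⟩ := hh
  have hpos : 0 < Real.arctan (1 - h / 2) := Real.arctan_pos.2 (by linarith)
  have hlt : Real.arctan (1 - h / 2) < Real.pi / 4 :=
    Real.arctan_one ▸ Real.arctan_strictMono (by linarith : 1 - h / 2 < 1)
  constructor <;> linarith [Real.pi_gt_three]

lemma sin_add_self_lt_pi {x : ℝ} (hx : x < Real.pi) : Real.sin x + x < Real.pi := by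
  have := Real.sin_lt (sub_pos.2 hx)
  rw [Real.sin_pi_sub] at this
  linarith

lemma hasDerivAt_opening_angle (h : ℝ) :
    HasDerivAt (fun x : ℝ => 2 * Real.arctan ((2 - x) / 2) + x / 2)
      (-(h * (4 - h)) / (2 * (h ^ 2 - 4 * h + 8))) h := by
  have hx := (((hasDerivAt_id h).const_sub 2).div_const 2).arctan
  refine ((hx.const_mul 2).add ((hasDerivAt_id h).div_const 2)).congr_deriv ?_
  have hden : h ^ 2 - 4 * h + 8 ≠ 0 := by nlinarith [sq_nonneg (h - 2)]
  simp only [id]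
  rw [show 1 + ((2 - h) / 2) ^ 2 = (h ^ 2 - 4 * h + 8) / 4 by ring,
    show h * (4 - h) = 8 - (h ^ 2 - 4 * h + 8) by ring]
  generalize h ^ 2 - 4 * h + 8 = d at hden
  field_simp
  ring

/-- The two-holes example: with `θ₀(h) = 2 arctan((2−h)/2) + h/2` and
`f(h) = |sin θ₀(h) + θ₀(h) − π|`, one has `f(0) = π/2 − 1`, `f` is differentiable on `(0,2)`
with the explicit positive derivative, and hence `f(h) > π/2 − 1` on `(0,2)` (the bowing
depth strictly increases at the second hole). -/
theorem two_holes_bowing_depth (θ₀ f : ℝ → ℝ)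
    (hθ : ∀ h : ℝ, θ₀ h = 2 * Real.arctan ((2 - h) / 2) + h / 2)
    (hf : ∀ h : ℝ, f h = |Real.sin (θ₀ h) + θ₀ h - Real.pi|) :
    f 0 = Real.pi / 2 - 1 ∧
    (∀ h ∈ Ioo (0:ℝ) 2,
        HasDerivAt f
          (h * (4 - h) * (Real.cos (h / 4 + Real.arctan (1 - h / 2)))^2 / (h^2 - 4*h + 8)) h ∧
        0 < h * (4 - h) * (Real.cos (h / 4 + Real.arctan (1 - h / 2)))^2 / (h^2 - 4*h + 8)) ∧
    (∀ h ∈ Ioo (0:ℝ) 2, Real.pi / 2 - 1 < f h) := by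
  have hhalf (h : ℝ) : θ₀ h = 2 * (h / 4 + Real.arctan (1 - h / 2)) := by
    rw [hθ, show (2 - h) / 2 = 1 - h / 2 by ring]
    ring
  have hf0 : f 0 = Real.pi / 2 - 1 := by
    have hθ0 : θ₀ 0 = Real.pi / 2 := by
      rw [hhalf]
      norm_num
      ring
    rw [hf, hθ0, Real.sin_pi_div_two, abs_of_neg (by linarith [Real.pi_gt_three])]
    ring
  have hderiv : ∀ h ∈ Ioo (0 : ℝ) 2, HasDerivAt f
      (h * (4 - h) * (Real.cos (h / 4 + Real.arctan (1 - h / 2))) ^ 2 /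
        (h ^ 2 - 4 * h + 8)) h := by
    intro h hh
    have hθ' : HasDerivAt θ₀ (-(h * (4 - h)) / (2 * (h ^ 2 - 4 * h + 8))) h :=
      funext hθ ▸ hasDerivAt_opening_angle h
    have heq : f =ᶠ[nhds h] fun x => -(Real.sin (θ₀ x) + θ₀ x - Real.pi) := by
      filter_upwards [isOpen_Ioo.mem_nhds hh] with x hx
      have hlt : θ₀ x < Real.pi := by
        rw [hhalf]
        linarith [(half_opening_angle_mem_Ioo hx).2]
      rw [hf, abs_of_neg (by linarith [sin_add_self_lt_pi hlt])]
    refine HasDerivAt.congr_of_eventuallyEq ?_ heq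
    refine ((hθ'.sin.add hθ').sub_const Real.pi).neg.congr_deriv ?_
    have hden : h ^ 2 - 4 * h + 8 ≠ 0 := by nlinarith [sq_nonneg (h - 2)]
    rw [hhalf, Real.cos_two_mul]
    field_simp
    ring
  have hpos : ∀ h ∈ Ioo (0 : ℝ) 2,
      0 < h * (4 - h) * (Real.cos (h / 4 + Real.arctan (1 - h / 2))) ^ 2 /
        (h ^ 2 - 4 * h + 8) := by
    intro h hh
    have hmem := half_opening_angle_mem_Ioo hh
    have hcos := Real.cos_pos_of_mem_Ioo
      ⟨by linarith [hmem.1, Real.pi_pos], hmem.2⟩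
    have hden : 0 < h ^ 2 - 4 * h + 8 := by nlinarith [sq_nonneg (h - 2)]
    have h0 := hh.1
    have h4 : 0 < 4 - h := by linarith [hh.2]
    positivity
  refine ⟨hf0, fun h hh => ⟨hderiv h hh, hpos h hh⟩, fun h hh => ?_⟩
  have hcont : Continuous f := by
    rw [funext hf, funext hθ]
    fun_prop
  have hmono : StrictMonoOn f (Icc 0 2) := by
    refine strictMonoOn_of_deriv_pos (convex_Icc 0 2) hcont.continuousOn fun x hx => ?_
    rw [interior_Icc] at hx
    rw [(hderiv x hx).deriv]
    exact hpos x hx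
  exact hf0 ▸ hmono ⟨le_rfl, zero_le_two⟩ (Ioo_subset_Icc_self hh) hh.1
end
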